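/- If κ is the least uplifting cardinal, then κ is not Σ₄-reflecting, and there are no Σ₄-reflecting cardinals below κ. -/

import Mathlib

open FirstOrder Language

universe u

namespace Paper

/-- The language of set theory: a single binary relation symbol (membership).
We reuse `FirstOrder.Language.graph`, whose sole symbol is a binary relation. -/
abbrev LSet : FirstOrder.Language := FirstOrder.Language.graph

/-- The rank-initial segment `V_α` of the cumulative hierarchy, realized as the
collection of ZF sets of rank less than `α`. -/
abbrev Vt (α : Ordinal) : Type 1 := {x : ZFSet // x.rank < α}

/-- `V_α` as a structure in the language of set theory, with the membership relation. -/
instance VtStructure (α : Ordinal) : LSet.Structure (Vt α) where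
  funMap := fun f _ => f.elim
  RelMap := fun r x => match r with | .adj => (x 0).1 ∈ (x 1).1

/-- The universe of sets as a structure in the language of set theory. -/
instance ZFSetStructure : LSet.Structure ZFSet where
  funMap := fun f _ => f.elim
  RelMap := fun r x => match r with | .adj => x 0 ∈ x 1

/-- `V_α ≺ V_β`: the inclusion of `V_α` into `V_β` is an elementary embedding. -/
def VElem (α β : Ordinal) : Prop :=
  ∃ e : Vt α ↪ₑ[LSet] Vt β, ∀ x : Vt α, (e x : ZFSet) = x

/-- An ordinal which is a cardinal. -/
def IsCardOrd (γ : Ordinal) : Prop := γ.card.ord = γ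

/-- An ordinal which is a regular cardinal. -/
def IsRegularOrd (γ : Ordinal) : Prop := γ.card.IsRegular ∧ γ.card.ord = γ

/-- An ordinal which is an inaccessible cardinal (uncountable, regular, strong limit). -/
def IsInaccOrd (γ : Ordinal) : Prop := γ.card.IsInaccessible ∧ γ.card.ord = γ

/-- An inaccessible cardinal `κ` is uplifting if for every ordinal `θ` there is an
inaccessible cardinal `γ ≥ θ` such that `V_κ ≺ V_γ` is a proper elementary extension. -/
def IsUplifting (κ : Ordinal) : Prop :=
  IsInaccOrd κ ∧ ∀ θ : Ordinal, ∃ γ : Ordinal, IsInaccOrd γ ∧ θ ≤ γ ∧ κ < γ ∧ VElem κ γ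

/-- An inaccessible cardinal `κ` is pseudo uplifting if for every ordinal `θ` there is a
cardinal `γ ≥ θ` such that `V_κ ≺ V_γ` is a proper elementary extension. -/
def IsPseudoUplifting (κ : Ordinal) : Prop :=
  IsInaccOrd κ ∧ ∀ θ : Ordinal, ∃ γ : Ordinal, IsCardOrd γ ∧ θ ≤ γ ∧ κ < γ ∧ VElem κ γ

/-- The membership formula `t₁ ∈ t₂` between two terms. -/
def memBF {α : Type} {n : ℕ} (t₁ t₂ : LSet.Term (α ⊕ Fin n)) : LSet.BoundedFormula α n :=
  Language.adj.boundedFormula₂ t₁ t₂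

/-- A formula of the language of set theory all of whose quantifiers are bounded
(of the form `∀ x ∈ t` or `∃ x ∈ t`): the Δ₀ formulas. -/
inductive IsDelta0 : ∀ {α : Type} {n : ℕ}, LSet.BoundedFormula α n → Prop
  | of_isQF {α n} {φ : LSet.BoundedFormula α n} : φ.IsQF → IsDelta0 φ
  | imp {α n} {φ ψ : LSet.BoundedFormula α n} :
      IsDelta0 φ → IsDelta0 ψ → IsDelta0 (φ.imp ψ)
  | ball {α n} (t : LSet.Term (α ⊕ Fin n)) {φ : LSet.BoundedFormula α (n + 1)} :
      IsDelta0 φ →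
      IsDelta0 ((memBF (Term.var (Sum.inr (Fin.last n)))
        (t.relabel (Sum.map id Fin.castSucc)) ⟹ φ).all)
  | bex {α n} (t : LSet.Term (α ⊕ Fin n)) {φ : LSet.BoundedFormula α (n + 1)} :
      IsDelta0 φ →
      IsDelta0 ((memBF (Term.var (Sum.inr (Fin.last n)))
        (t.relabel (Sum.map id Fin.castSucc)) ⊓ φ).ex)

mutual
  /-- Σₖ formulas: `k` alternating blocks of quantifiers beginning with an existential
  block, followed by a Δ₀ formula (degenerate blocks allowed). -/
  inductive IsSigmaFml : ℕ → ∀ {α : Type} {n : ℕ}, LSet.BoundedFormula α n → Prop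
    | of_delta0 {k : ℕ} {α n} {φ : LSet.BoundedFormula α n} : IsDelta0 φ → IsSigmaFml k φ
    | of_pi {k : ℕ} {α n} {φ : LSet.BoundedFormula α n} : IsPiFml k φ → IsSigmaFml (k + 1) φ
    | ex {k : ℕ} {α n} {φ : LSet.BoundedFormula α (n + 1)} :
        IsSigmaFml (k + 1) φ → IsSigmaFml (k + 1) φ.ex
  /-- Πₖ formulas: `k` alternating blocks of quantifiers beginning with a universal
  block, followed by a Δ₀ formula (degenerate blocks allowed). -/
  inductive IsPiFml : ℕ → ∀ {α : Type} {n : ℕ}, LSet.BoundedFormula α n → Prop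
    | of_delta0 {k : ℕ} {α n} {φ : LSet.BoundedFormula α n} : IsDelta0 φ → IsPiFml k φ
    | of_sigma {k : ℕ} {α n} {φ : LSet.BoundedFormula α n} : IsSigmaFml k φ → IsPiFml (k + 1) φ
    | all {k : ℕ} {α n} {φ : LSet.BoundedFormula α (n + 1)} :
        IsPiFml (k + 1) φ → IsPiFml (k + 1) φ.all
end

/-- An inaccessible cardinal `κ` is Σₖ-reflecting if for every Σₖ formula `φ(x)` and every
`a ∈ V_κ`, `φ(a)` holds in the universe of sets if and only if `V_κ ⊨ φ(a)`. -/
def SigmaReflecting (k : ℕ) (κ : Ordinal) : Prop :=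
  IsInaccOrd κ ∧ ∀ φ : LSet.Formula (Fin 1), IsSigmaFml k φ →
    ∀ (a : ZFSet) (ha : a.rank < κ),
      (φ.Realize (fun _ => a) ↔ φ.Realize (fun _ => (⟨a, ha⟩ : Vt κ)))

section Definability

variable {ι : Type} {n : ℕ}

/-- A property of assignments, uniform in the structure `(M, E)`. -/
abbrev SetPred (ι : Type) (n : ℕ) : Type 2 :=
  ∀ M : Type 1, (M → M → Prop) → (ι ⊕ Fin n → M) → Prop

/-- The formula `φ` expresses the property `P` in every structure. -/
def Expresses (φ : LSet.BoundedFormula ι n) (P : SetPred ι n) : Prop :=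
  ∀ (M : Type 1) [LSet.Structure M] (s : ι ⊕ Fin n → M),
    φ.Realize (s ∘ Sum.inl) (s ∘ Sum.inr) ↔
      P M (fun a b => Structure.RelMap Language.adj ![a, b]) s

/-- `P` is expressed by a Δ₀ formula. -/
def Delta0Def (P : SetPred ι n) : Prop := ∃ φ, IsDelta0 φ ∧ Expresses φ P

/-- `P` is expressed by a Σₖ formula. -/
def SigmaDef (k : ℕ) (P : SetPred ι n) : Prop := ∃ φ, IsSigmaFml k φ ∧ Expresses φ P

/-- `P` is expressed by a Πₖ formula. -/
def PiDef (k : ℕ) (P : SetPred ι n) : Prop := ∃ φ, IsPiFml k φ ∧ Expresses φ P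

/-- The property of assignments to `n + 1` bound variables obtained from `P` by reading its
last argument from the last variable. -/
abbrev openLast (P : ∀ M : Type 1, (M → M → Prop) → (ι ⊕ Fin n → M) → M → Prop) :
    SetPred ι (n + 1) :=
  fun M E s => P M E (fun j => s (Sum.map id Fin.castSucc j)) (s (Sum.inr (Fin.last n)))

lemma realize_snoc_iff {φ : LSet.BoundedFormula ι (n + 1)}
    {P : ∀ M : Type 1, (M → M → Prop) → (ι ⊕ Fin n → M) → M → Prop}
    (h : Expresses φ (openLast P)) (M : Type 1) [LSet.Structure M] (s : ι ⊕ Fin n → M) (b : M) :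
    φ.Realize (s ∘ Sum.inl) (Fin.snoc (s ∘ Sum.inr) b) ↔
      P M (fun a b => Structure.RelMap Language.adj ![a, b]) s b := by
  have := h M (Sum.elim (s ∘ Sum.inl) (Fin.snoc (s ∘ Sum.inr) b : Fin (n + 1) → M))
  rw [Sum.elim_comp_inl, Sum.elim_comp_inr] at this
  rw [this]
  have hs : (fun j => Sum.elim (s ∘ Sum.inl) (Fin.snoc (s ∘ Sum.inr) b : Fin (n + 1) → M)
      (Sum.map id Fin.castSucc j)) = s := by
    funext j
    rcases j with j | j <;> simp
  simp only [openLast, hs, Sum.elim_inr, Fin.snoc_last]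

lemma realize_memBF_last (i : ι ⊕ Fin n) (M : Type 1) [LSet.Structure M]
    (s : ι ⊕ Fin n → M) (b : M) :
    (memBF (Term.var (Sum.inr (Fin.last n)))
        ((Term.var i : LSet.Term (ι ⊕ Fin n)).relabel (Sum.map id Fin.castSucc))).Realize
      (s ∘ Sum.inl) (Fin.snoc (s ∘ Sum.inr) b) ↔
      Structure.RelMap Language.adj ![b, s i] := by
  rw [memBF, BoundedFormula.realize_rel₂]
  rcases i with i | i <;> simp

namespace Delta0Def

lemma mem (i j : ι ⊕ Fin n) : Delta0Def fun _ E s => E (s i) (s j) := by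
  refine ⟨memBF (Term.var i) (Term.var j), .of_isQF (.of_isAtomic (.rel _ _)), fun M _ s => ?_⟩
  rw [memBF, BoundedFormula.realize_rel₂]
  rcases i with i | i <;> rcases j with j | j <;> simp

lemma eq (i j : ι ⊕ Fin n) : Delta0Def fun _ _ s => s i = s j := by
  refine ⟨(Term.var i).bdEqual (Term.var j), .of_isQF (.of_isAtomic (.equal _ _)), fun M _ s => ?_⟩
  rw [BoundedFormula.realize_bdEqual]
  rcases i with i | i <;> rcases j with j | j <;> simp

lemma false : Delta0Def (ι := ι) (n := n) fun _ _ _ => False :=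
  ⟨⊥, .of_isQF .falsum, fun _ _ _ => Iff.rfl⟩

variable {P Q : SetPred ι n}

lemma imp (hP : Delta0Def P) (hQ : Delta0Def Q) : Delta0Def fun M E s => P M E s → Q M E s := by
  obtain ⟨φ, hφ, hP⟩ := hP
  obtain ⟨ψ, hψ, hQ⟩ := hQ
  refine ⟨φ.imp ψ, hφ.imp hψ, fun M _ s => ?_⟩
  rw [BoundedFormula.realize_imp, hP, hQ]

lemma congr (hP : Delta0Def P) (h : ∀ M E s, P M E s ↔ Q M E s) : Delta0Def Q := by
  obtain ⟨φ, hφ, hP⟩ := hP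
  exact ⟨φ, hφ, fun M _ s => (hP M s).trans (h _ _ _)⟩

lemma not (hP : Delta0Def P) : Delta0Def fun M E s => ¬ P M E s := hP.imp false

lemma and (hP : Delta0Def P) (hQ : Delta0Def Q) : Delta0Def fun M E s => P M E s ∧ Q M E s :=
  (hP.imp hQ.not).not.congr fun _ _ _ => by tauto

lemma or (hP : Delta0Def P) (hQ : Delta0Def Q) : Delta0Def fun M E s => P M E s ∨ Q M E s :=
  (hP.not.imp hQ).congr fun _ _ _ => by tauto

lemma iff (hP : Delta0Def P) (hQ : Delta0Def Q) :
    Delta0Def fun M E s => (P M E s ↔ Q M E s) :=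
  ((hP.imp hQ).and (hQ.imp hP)).congr fun _ _ _ => by tauto

variable {R : ∀ M : Type 1, (M → M → Prop) → (ι ⊕ Fin n → M) → M → Prop}

lemma ball (i : ι ⊕ Fin n) (hR : Delta0Def (openLast R)) :
    Delta0Def fun M E s => ∀ b, E b (s i) → R M E s b := by
  obtain ⟨φ, hφ, hR⟩ := hR
  refine ⟨_, .ball (Term.var i) hφ, fun M _ s => ?_⟩
  rw [BoundedFormula.realize_all]
  refine forall_congr' fun b => ?_
  rw [BoundedFormula.realize_imp, realize_memBF_last, realize_snoc_iff hR]

lemma bex (i : ι ⊕ Fin n) (hR : Delta0Def (openLast R)) :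
    Delta0Def fun M E s => ∃ b, E b (s i) ∧ R M E s b := by
  obtain ⟨φ, hφ, hR⟩ := hR
  refine ⟨_, .bex (Term.var i) hφ, fun M _ s => ?_⟩
  rw [BoundedFormula.realize_ex]
  refine exists_congr fun b => ?_
  rw [BoundedFormula.realize_inf, realize_memBF_last, realize_snoc_iff hR]

end Delta0Def

variable {k : ℕ} {P : SetPred ι n}
  {R : ∀ M : Type 1, (M → M → Prop) → (ι ⊕ Fin n → M) → M → Prop}

lemma Delta0Def.piDef (h : Delta0Def P) : PiDef k P :=
  let ⟨φ, hφ, hP⟩ := h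
  ⟨φ, .of_delta0 hφ, hP⟩

lemma PiDef.sigmaDef (h : PiDef k P) : SigmaDef (k + 1) P :=
  let ⟨φ, hφ, hP⟩ := h
  ⟨φ, .of_pi hφ, hP⟩

lemma SigmaDef.piDef (h : SigmaDef k P) : PiDef (k + 1) P :=
  let ⟨φ, hφ, hP⟩ := h
  ⟨φ, .of_sigma hφ, hP⟩

lemma PiDef.all (h : PiDef (k + 1) (openLast R)) :
    PiDef (k + 1) fun M E s => ∀ b, R M E s b :=
  let ⟨φ, hφ, hR⟩ := h
  ⟨φ.all, .all hφ, fun M _ s => forall_congr' fun b => realize_snoc_iff hR M s b⟩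

lemma SigmaDef.ex (h : SigmaDef (k + 1) (openLast R)) :
    SigmaDef (k + 1) fun M E s => ∃ b, R M E s b :=
  let ⟨φ, hφ, hR⟩ := h
  ⟨φ.ex, .ex hφ, fun M _ s =>
    BoundedFormula.realize_ex.trans (exists_congr fun b => realize_snoc_iff hR M s b)⟩

end Definability

section Predicates

variable {M : Type 1} (E : M → M → Prop)

/-- `a` is a subset of `b`. -/
def SubE (a b : M) : Prop := ∀ c, E c a → E c b

/-- `p` is the unordered pair `{a, b}`. -/
def IsUPairE (p a b : M) : Prop := E a p ∧ E b p ∧ ∀ c, E c p → c = a ∨ c = b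

/-- `p` is the Kuratowski pair `(a, b)`. -/
def IsOPairE (p a b : M) : Prop :=
  (∃ q, E q p ∧ IsUPairE E q a a) ∧ (∃ q, E q p ∧ IsUPairE E q a b) ∧
    ∀ q, E q p → IsUPairE E q a a ∨ IsUPairE E q a b

/-- The Kuratowski pair `(a, b)` belongs to `z`. -/
def PairMemE (z a b : M) : Prop := ∃ p, E p z ∧ IsOPairE E p a b

/-- The matrix of a Π₁ definition (universally quantified over `z`) of `u = V_κ` for an
inaccessible cardinal `κ`. -/
def UnivE (u z : M) : Prop :=
  (∀ a, E a u → ∀ b, E b a → E b u) ∧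
  (∀ a, E a u → SubE E z a → E z u) ∧
  (∀ a, E a u → ∃ p, E p u ∧ ∀ b, E b u → SubE E b a → E b p) ∧
  (∀ a, E a u → ∃ b, E b u ∧ ∀ c, E c a → ∀ d, E d c → E d b) ∧
  (∀ a, E a u → (∀ c, E c a → ∃ d, E d u ∧ PairMemE E z c d) →
    ∃ r, E r u ∧ ∀ c, E c a → ∃ d, E d r ∧ PairMemE E z c d) ∧
  ∃ w, E w u ∧ (∃ m, E m w ∧ E m u) ∧ ∀ m, E m w → ∃ m', E m' w ∧ E m m'

/-- `F` contains relations on `y` coding the atomic formulas, where a tuple is coded by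
iterated pairs `((∅, a₀), a₁), …`, and is closed under operations coding substitution
of variables. -/
def AtomicE (y F : M) : Prop :=
  (∀ S, E S F → ∃ R, E R F ∧ ∀ z, E z y → ∀ b, E b y → (PairMemE E R z b ↔ E z S)) ∧
  (∀ S, E S F → ∃ R, E R F ∧ ∀ z, E z y → ∀ a, E a y → ∀ b, E b y → ∀ p, E p y →
    IsOPairE E p z a → (PairMemE E R p b ↔ PairMemE E S z b)) ∧
  (∃ R, E R F ∧ ∀ z, E z y → ∀ a, E a y → ∀ b, E b y → ∀ p, E p y →
    IsOPairE E p z a → (PairMemE E R p b ↔ E a b)) ∧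
  (∃ R, E R F ∧ ∀ z, E z y → ∀ a, E a y → ∀ b, E b y → ∀ p, E p y →
    IsOPairE E p z a → (PairMemE E R p b ↔ E b a)) ∧
  ∃ R, E R F ∧ ∀ z, E z y → ∀ a, E a y → ∀ b, E b y → ∀ p, E p y →
    IsOPairE E p z a → (PairMemE E R p b ↔ a = b)

/-- `F` is closed under operations on relations on `y` coding the logical operations. -/
def LogicalE (y F : M) : Prop :=
  (∃ R, E R F ∧ ∀ z, E z y → ¬ E z R) ∧
  (∀ S, E S F → ∀ S', E S' F → ∃ R, E R F ∧ ∀ z, E z y → (E z R ↔ (E z S → E z S'))) ∧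
  ∀ S, E S F → ∃ R, E R F ∧ ∀ z, E z y → (E z R ↔ ∀ b, E b y → PairMemE E S z b)

/-- `T` contains all codes of tuples from `x`, and the relations in `F` pass the
Tarski–Vaught test for `x` inside `y`. -/
def TarskiVaughtE (x y F T : M) : Prop :=
  (∃ e, E e T ∧ ∀ c, E c e → False) ∧
  (∀ z, E z T → ∀ b, E b x → ∃ p, E p T ∧ IsOPairE E p z b) ∧
  ∀ S, E S F → ∀ z, E z T → (∃ b, E b y ∧ PairMemE E S z b) → ∃ b, E b x ∧ PairMemE E S z b

/-- The Δ₀ matrix of `UpliftingE`. -/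
def UpliftingMatrixE (x t y F T z : M) : Prop :=
  UnivE E x z ∧ UnivE E y z ∧ E t y ∧ E x y ∧ AtomicE E y F ∧ LogicalE E y F ∧
    TarskiVaughtE E x y F T

/-- A Π₃ definition of `x = V_κ` for an uplifting cardinal `κ`. -/
def UpliftingE (x : M) : Prop := ∀ t, ∃ y F T, ∀ z, UpliftingMatrixE E x t y F T z

end Predicates

section PredicatesDefinable

variable {ι : Type} {n : ℕ}

open Delta0Def

lemma delta0Def_subE (i j : ι ⊕ Fin n) : Delta0Def fun _ E s => SubE E (s i) (s j) :=
  ball _ (mem _ _)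

lemma delta0Def_isUPairE (i j k : ι ⊕ Fin n) :
    Delta0Def fun _ E s => IsUPairE E (s i) (s j) (s k) :=
  and (mem _ _) (and (mem _ _) (ball _ (or (eq _ _) (eq _ _))))

lemma delta0Def_isOPairE (i j k : ι ⊕ Fin n) :
    Delta0Def fun _ E s => IsOPairE E (s i) (s j) (s k) :=
  and (bex _ (delta0Def_isUPairE _ _ _)) (and (bex _ (delta0Def_isUPairE _ _ _))
    (ball _ (or (delta0Def_isUPairE _ _ _) (delta0Def_isUPairE _ _ _))))

lemma delta0Def_pairMemE (i j k : ι ⊕ Fin n) :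
    Delta0Def fun _ E s => PairMemE E (s i) (s j) (s k) :=
  bex _ (delta0Def_isOPairE _ _ _)

lemma delta0Def_univE (i j : ι ⊕ Fin n) : Delta0Def fun _ E s => UnivE E (s i) (s j) :=
  and (ball _ (ball _ (mem _ _))) <|
  and (ball _ (imp (delta0Def_subE _ _) (mem _ _))) <|
  and (ball _ (bex _ (ball _ (imp (delta0Def_subE _ _) (mem _ _))))) <|
  and (ball _ (bex _ (ball _ (ball _ (mem _ _))))) <|
  and (ball _ (imp (ball _ (bex _ (delta0Def_pairMemE _ _ _)))
    (bex _ (ball _ (bex _ (delta0Def_pairMemE _ _ _)))))) <|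
  bex _ (and (bex _ (mem _ _)) (ball _ (bex _ (mem _ _))))

lemma delta0Def_atomicE (i j : ι ⊕ Fin n) : Delta0Def fun _ E s => AtomicE E (s i) (s j) :=
  and (ball _ (bex _ (ball _ (ball _ (iff (delta0Def_pairMemE _ _ _) (mem _ _)))))) <|
  and (ball _ (bex _ (ball _ (ball _ (ball _ (ball _ (imp (delta0Def_isOPairE _ _ _)
    (iff (delta0Def_pairMemE _ _ _) (delta0Def_pairMemE _ _ _))))))))) <|
  and (bex _ (ball _ (ball _ (ball _ (ball _ (imp (delta0Def_isOPairE _ _ _)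
    (iff (delta0Def_pairMemE _ _ _) (mem _ _)))))))) <|
  and (bex _ (ball _ (ball _ (ball _ (ball _ (imp (delta0Def_isOPairE _ _ _)
    (iff (delta0Def_pairMemE _ _ _) (mem _ _)))))))) <|
  bex _ (ball _ (ball _ (ball _ (ball _ (imp (delta0Def_isOPairE _ _ _)
    (iff (delta0Def_pairMemE _ _ _) (eq _ _)))))))

lemma delta0Def_logicalE (i j : ι ⊕ Fin n) : Delta0Def fun _ E s => LogicalE E (s i) (s j) :=
  and (bex _ (ball _ (not (mem _ _)))) <|
  and (ball _ (ball _ (bex _ (ball _ (iff (mem _ _) (imp (mem _ _) (mem _ _))))))) <|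
  ball _ (bex _ (ball _ (iff (mem _ _) (ball _ (delta0Def_pairMemE _ _ _)))))

lemma delta0Def_tarskiVaughtE (i j k l : ι ⊕ Fin n) :
    Delta0Def fun _ E s => TarskiVaughtE E (s i) (s j) (s k) (s l) :=
  and (bex _ (ball _ false)) <|
  and (ball _ (ball _ (bex _ (delta0Def_isOPairE _ _ _)))) <|
  ball _ (ball _ (imp (bex _ (delta0Def_pairMemE _ _ _)) (bex _ (delta0Def_pairMemE _ _ _))))

lemma delta0Def_upliftingMatrixE (i j k l p q : ι ⊕ Fin n) :
    Delta0Def fun _ E s => UpliftingMatrixE E (s i) (s j) (s k) (s l) (s p) (s q) :=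
  and (delta0Def_univE _ _) <| and (delta0Def_univE _ _) <| and (mem _ _) <| and (mem _ _) <|
    and (delta0Def_atomicE _ _) <| and (delta0Def_logicalE _ _) (delta0Def_tarskiVaughtE _ _ _ _)

lemma piDef_upliftingE (i : ι ⊕ Fin n) : PiDef 3 fun _ E s => UpliftingE E (s i) :=
  .all <| SigmaDef.piDef <| .ex <| .ex <| .ex <| PiDef.sigmaDef <| .all <|
    (delta0Def_upliftingMatrixE _ _ _ _ _ _).piDef

end PredicatesDefinable

section Universes

open Cardinal Ordinal Order ZFSet

/-- The membership relation of the universe of sets. -/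
abbrev memE : ZFSet → ZFSet → Prop := fun a b => a ∈ b

lemma isUPairE_iff {p a b : ZFSet} : IsUPairE memE p a b ↔ p = {a, b} := by
  constructor
  · rintro ⟨ha, hb, h⟩
    ext c
    rw [mem_pair]
    exact ⟨h c, by rintro (rfl | rfl) <;> assumption⟩
  · rintro rfl
    simp [IsUPairE]

lemma isOPairE_iff {p a b : ZFSet} : IsOPairE memE p a b ↔ p = pair a b := by
  simp only [IsOPairE, isUPairE_iff, exists_eq_right, pair_eq_singleton, pair]
  constructor
  · rintro ⟨ha, hb, h⟩
    ext c
    rw [mem_pair]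
    exact ⟨h c, by rintro (rfl | rfl) <;> assumption⟩
  · rintro rfl
    simp

lemma pairMemE_iff {z a b : ZFSet} : PairMemE memE z a b ↔ pair a b ∈ z := by
  simp only [PairMemE, isOPairE_iff, exists_eq_right]

lemma rank_opair_lt {κ : Ordinal} (hκ : IsSuccLimit κ) {a b : ZFSet} (ha : a.rank < κ)
    (hb : b.rank < κ) : (pair a b).rank < κ := by
  simp only [pair, rank_pair, rank_singleton]
  exact max_lt (hκ.succ_lt (hκ.succ_lt ha))
    (hκ.succ_lt (max_lt (hκ.succ_lt ha) (hκ.succ_lt hb)))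

lemma IsInaccOrd.isSuccLimit {κ : Ordinal} (h : IsInaccOrd κ) : IsSuccLimit κ :=
  h.2 ▸ isSuccLimit_ord h.1.aleph0_lt.le

lemma IsInaccOrd.cof_eq {κ : Ordinal} (h : IsInaccOrd κ) : κ.cof = κ.card := by
  conv_lhs => rw [← h.2]
  exact h.1.isRegular.cof_ord

lemma IsInaccOrd.card_lt {κ : Ordinal} (h : IsInaccOrd κ) {a : ZFSet} (ha : a.rank < κ) :
    a.card < κ.card := by
  refine (card_mono (subset_vonNeumann_self a)).trans_lt ?_
  rw [card_vonNeumann, ← h.1.preBeth_ord, h.2]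
  exact preBeth_strictMono ha

lemma IsInaccOrd.exists_rank_bound {κ : Ordinal} (h : IsInaccOrd κ) {a : ZFSet}
    (ha : a.rank < κ) (f : a → ZFSet) (hf : ∀ c, (f c).rank < κ) :
    ∃ β < κ, ∀ c, (f c).rank < β := by
  refine ⟨⨆ c, ((f c).rank + 1), lift_iSup_add_one_lt_of_lt_cof ?_ hf, fun c => ?_⟩
  · rw [← lift_cof, h.cof_eq, cardinalMk_coe_sort, Cardinal.lift_lift]
    exact Cardinal.lift_lt.2 (h.card_lt ha)
  · rw [← Order.add_one_le_iff]
    exact le_ciSup (f := fun c => (f c).rank + 1) bddAbove_of_small c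

lemma IsInaccOrd.univE {κ : Ordinal} (h : IsInaccOrd κ) (z : ZFSet) :
    UnivE memE (V_ κ) z := by
  have hlim := h.isSuccLimit
  refine ⟨fun a ha b hb => isTransitive_vonNeumann κ a ha hb,
    fun a ha hz => mem_vonNeumann_of_subset (fun c hc => hz c hc) ha, fun a ha => ?_,
    fun a ha => ?_, fun a ha hz => ?_, ?_⟩
  · refine ⟨powerset a, ?_, fun b _ hb => mem_powerset.2 fun c hc => hb c hc⟩
    rw [memE, mem_vonNeumann] at *
    rw [rank_powerset]
    exact hlim.succ_lt ha
  · refine ⟨⋃₀ a, ?_, fun c hc d hd => mem_sUnion.2 ⟨c, hc, hd⟩⟩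
    rw [memE, mem_vonNeumann] at *
    exact (rank_sUnion_le a).trans_lt ha
  · choose! f hfu hfz using hz
    rw [memE, mem_vonNeumann] at ha
    obtain ⟨β, hβ, hb⟩ := h.exists_rank_bound ha (fun c => f c)
      fun c => mem_vonNeumann.1 (hfu c c.2)
    exact ⟨V_ β, vonNeumann_mem_of_lt hβ,
      fun c hc => ⟨f c, mem_vonNeumann.2 (hb ⟨c, hc⟩), hfz c hc⟩⟩
  · have hω : ω < κ := by
      rw [← h.2, ← ord_aleph0]
      exact ord_strictMono h.1.aleph0_lt
    refine ⟨V_ ω, vonNeumann_mem_of_lt hω, ⟨∅, ?_, ?_⟩, fun m hm => ⟨{m}, ?_, ?_⟩⟩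
    · simp [mem_vonNeumann, omega0_pos]
    · simpa [mem_vonNeumann] using omega0_pos.trans hω
    · simp only [memE, mem_vonNeumann, rank_singleton] at *
      exact isSuccLimit_omega0.succ_lt hm
    · simp

variable {u : ZFSet}

lemma exists_collection (h : ∀ z, UnivE memE u z) {a : ZFSet} (ha : a ∈ u)
    (f : ZFSet → ZFSet) (hf : ∀ c ∈ a, f c ∈ u) : ∃ r ∈ u, ∀ c ∈ a, f c ∈ r := by
  obtain ⟨-, -, -, -, hcol, -⟩ := h ((prod a u).sep fun p => ∃ c, p = pair c (f c))
  have key : ∀ c d, PairMemE memE ((prod a u).sep fun p => ∃ c, p = pair c (f c)) c d ↔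
      (c ∈ a ∧ d ∈ u) ∧ d = f c := by
    intro c d
    rw [pairMemE_iff, mem_sep, pair_mem_prod]
    refine and_congr_right fun _ => ⟨?_, fun hd => ⟨c, by rw [hd]⟩⟩
    rintro ⟨c', h'⟩
    obtain ⟨rfl, rfl⟩ := pair_injective h'
    rfl
  obtain ⟨r, hr, hr'⟩ := hcol a ha fun c hc =>
    ⟨f c, hf c hc, (key _ _).2 ⟨⟨hc, hf c hc⟩, rfl⟩⟩
  refine ⟨r, hr, fun c hc => ?_⟩
  obtain ⟨d, hd, hp⟩ := hr' c hc
  rwa [← ((key _ _).1 hp).2]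

lemma powerset_mem (h : ∀ z, UnivE memE u z) {a : ZFSet} (ha : a ∈ u) : powerset a ∈ u := by
  obtain ⟨-, -, hpow, -⟩ := h ∅
  obtain ⟨p, hp, hp'⟩ := hpow a ha
  refine (h (powerset a)).2.1 p hp fun c hc => ?_
  have hca : c ⊆ a := mem_powerset.1 hc
  exact hp' c ((h c).2.1 a ha fun d hd => hca hd) fun d hd => hca hd

lemma vonNeumann_mem (h : ∀ z, UnivE memE u z) (a : ZFSet) (ha : a ∈ u) :
    V_ a.rank ∈ u := by
  induction a using ZFSet.inductionOn with
  | h a ih =>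
    obtain ⟨htr, -, -, hun, -⟩ := h ∅
    obtain ⟨r, hr, hr'⟩ := exists_collection h ha (fun b => powerset (V_ b.rank))
      fun b hb => powerset_mem h (ih b hb (htr a ha b hb))
    obtain ⟨s, hs, hs'⟩ := hun r hr
    refine (h _).2.1 s hs fun c hc => ?_
    rw [memE, mem_vonNeumann, lt_rank_iff] at hc
    obtain ⟨b, hb, hcb⟩ := hc
    exact hs' _ (hr' b hb) c (mem_powerset.2 (subset_vonNeumann.2 hcb))

lemma eq_vonNeumann_rank (h : ∀ z, UnivE memE u z) : u = V_ u.rank := by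
  ext c
  rw [mem_vonNeumann]
  refine ⟨rank_lt_of_mem, fun hc => ?_⟩
  obtain ⟨a, ha, hca⟩ := lt_rank_iff.1 hc
  exact (h c).2.1 _ (vonNeumann_mem h a ha) fun d hd => subset_vonNeumann.2 hca hd

lemma card_lt_cof_rank (h : ∀ z, UnivE memE u z) {a : ZFSet} (ha : a ∈ u) :
    a.card < u.rank.cof := by
  by_contra! hle
  have hu := eq_vonNeumann_rank h
  have hmem : ∀ c : ZFSet, c ∈ u ↔ c.rank < u.rank := fun c => by
    conv_lhs => rw [hu]
    exact mem_vonNeumann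
  obtain ⟨s, hs, hcard⟩ := Order.exists_cof_eq (Set.Iio u.rank)
  have hsa : #s ≤ #a := by
    rw [hcard, cof_Iio, ← lift_cof, cardinalMk_coe_sort]
    exact Cardinal.lift_le.2 hle
  obtain ⟨e⟩ := hsa
  have hinj : Function.Injective fun i : s => (e i : ZFSet) :=
    Subtype.val_injective.comp e.injective
  obtain ⟨r, hr, hr'⟩ := exists_collection h ha
    (Function.extend (fun i : s => (e i : ZFSet)) (fun i => toZFSet i.1.1) fun _ => ∅)
    (fun c _ => by
      by_cases hc : ∃ i : s, (e i : ZFSet) = c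
      · obtain ⟨i, rfl⟩ := hc
        rw [hinj.extend_apply, hmem, rank_toZFSet]
        exact i.1.2
      · rw [Function.extend_apply' _ _ _ hc, hmem, rank_empty]
        exact pos_of_gt (rank_lt_of_mem ha))
  obtain ⟨i, hi, hri⟩ := hs ⟨r.rank, rank_lt_of_mem hr⟩
  have := hr' _ (e ⟨i, hi⟩).2
  rw [hinj.extend_apply] at this
  have := rank_lt_of_mem this
  rw [rank_toZFSet] at this
  exact this.not_ge hri

lemma isInaccOrd_rank (h : ∀ z, UnivE memE u z) : IsInaccOrd u.rank := by
  have hu := eq_vonNeumann_rank h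
  have hmem : ∀ α < u.rank, toZFSet α ∈ u := fun α hα => by
    rw [hu, mem_vonNeumann, rank_toZFSet]
    exact hα
  have hlt : ∀ α < u.rank, α.card < u.rank.cof := fun α hα => by
    simpa using card_lt_cof_rank h (hmem α hα)
  have hord : u.rank.card.ord = u.rank := by
    refine (ord_card_le _).antisymm (le_of_not_gt fun hc => ?_)
    have := hlt _ hc
    rw [card_ord] at this
    exact this.not_ge (cof_le_card _)
  have hω : ω < u.rank := by
    obtain ⟨-, -, -, -, -, w, hw, ⟨m, hm, -⟩, hstep⟩ := h ∅
    refine lt_of_le_of_lt ?_ (rank_lt_of_mem hw)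
    refine omega0_le_of_isSuccLimit ⟨?_, ?_⟩
    · rw [isMin_iff_eq_bot]
      exact (pos_of_gt (rank_lt_of_mem hm)).ne'
    · refine isSuccPrelimit_of_succ_lt fun α hα => ?_
      obtain ⟨m, hm, hαm⟩ := lt_rank_iff.1 hα
      obtain ⟨m', hm', hmm'⟩ := hstep m hm
      exact (succ_le_of_lt (hαm.trans_lt (rank_lt_of_mem hmm'))).trans_lt (rank_lt_of_mem hm')
  refine ⟨⟨?_, ?_, fun c hc => ?_⟩, hord⟩
  · simpa using (hlt _ hω).trans_le (cof_le_card _)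
  · rw [hord]
    by_contra! hc
    have : u.rank.cof.ord < u.rank := (ord_strictMono hc).trans_eq hord
    simpa using hlt _ this
  · have hc' : c.ord < u.rank := (ord_strictMono hc).trans_eq hord
    have := card_lt_cof_rank h (powerset_mem h (hmem _ hc'))
    rw [card_powerset, card_toZFSet, card_ord] at this
    exact this.trans_le (cof_le_card _)

end Universes

section TupleCodes

open Order ZFSet

/-- The code `((∅, v₀), v₁), …` of a finite tuple of sets. -/
noncomputable def tupleCode : ∀ {n : ℕ}, (Fin n → ZFSet) → ZFSet
  | 0, _ => ∅
  | n + 1, v => pair (tupleCode fun i => v i.castSucc) (v (Fin.last n))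

/-- The code of a tuple of elements of `V_α`. -/
noncomputable abbrev vtCode {α : Ordinal} {n : ℕ} (v : Fin n → Vt α) : ZFSet :=
  tupleCode fun i => (v i : ZFSet)

lemma vtCode_succ {α : Ordinal} {n : ℕ} (v : Fin (n + 1) → Vt α) :
    vtCode v = pair (vtCode fun i => v i.castSucc) (v (Fin.last n) : ZFSet) := rfl

lemma vtCode_snoc {α : Ordinal} {n : ℕ} (v : Fin n → Vt α) (b : Vt α) :
    vtCode (Fin.snoc v b : Fin (n + 1) → Vt α) = pair (vtCode v) b := by
  simp [vtCode_succ]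

lemma rank_vtCode_lt {α : Ordinal} (hα : IsSuccLimit α) {n : ℕ} (v : Fin n → Vt α) :
    (vtCode v).rank < α := by
  induction n with
  | zero => simpa [vtCode, tupleCode] using hα.bot_lt
  | succ n ih =>
    rw [vtCode_succ]
    exact rank_opair_lt hα (ih _) (v _).2

lemma empty_ne_pair (a b : ZFSet) : ∅ ≠ pair a b := by
  intro h
  have : ({a} : ZFSet) ∈ pair a b := by simp [pair]
  exact notMem_empty _ (h ▸ this)

lemma term_eq_var {n : ℕ} (t : LSet.Term (Empty ⊕ Fin n)) :
    ∃ i, t = Term.var (Sum.inr i) := by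
  rcases t with ⟨i | i⟩ | ⟨f, -⟩
  · exact i.elim
  · exact ⟨i, rfl⟩
  · exact isEmptyElim f

end TupleCodes

section ElementaryOfMatrix

open Order ZFSet

variable {γ : Ordinal} {F : ZFSet}

lemma exists_code_last (hγ : IsSuccLimit γ) (hA : AtomicE memE (V_ γ) F)
    {r : ZFSet → ZFSet → Prop}
    (hr : ∃ R ∈ F, ∀ z ∈ V_ γ, ∀ a ∈ V_ γ, ∀ b ∈ V_ γ, ∀ p ∈ V_ γ,
      IsOPairE memE p z a → (PairMemE memE R p b ↔ r a b)) {n : ℕ} (i : Fin n) :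
    ∃ S ∈ F, ∀ v : Fin (n + 1) → Vt γ,
      vtCode v ∈ S ↔ r (v i.castSucc) (v (Fin.last n)) := by
  induction n with
  | zero => exact i.elim0
  | succ n ih =>
    have hmem (a : Vt γ) : (a : ZFSet) ∈ V_ γ := mem_vonNeumann.2 a.2
    have hcode {m : ℕ} (v : Fin m → Vt γ) : vtCode v ∈ V_ γ :=
      mem_vonNeumann.2 (rank_vtCode_lt hγ v)
    induction i using Fin.lastCases with
    | last =>
      obtain ⟨R, hR, h⟩ := hr
      refine ⟨R, hR, fun v => ?_⟩
      rw [vtCode_succ, ← pairMemE_iff]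
      exact h _ (hcode _) _ (hmem _) _ (hmem _) _ (hcode _) (isOPairE_iff.2 (vtCode_succ _))
    | cast i =>
      obtain ⟨S, hS, h⟩ := ih i
      obtain ⟨R, hR, hRS⟩ := hA.2.1 S hS
      refine ⟨R, hR, fun v => ?_⟩
      rw [vtCode_succ, ← pairMemE_iff]
      refine (hRS _ (hcode _) _ (hmem _) _ (hmem _) _ (hcode _)
        (isOPairE_iff.2 (vtCode_succ fun i => v i.castSucc))).trans ?_
      rw [pairMemE_iff, ← vtCode_snoc, h]
      simp

lemma exists_code_atomic (hγ : IsSuccLimit γ) (hA : AtomicE memE (V_ γ) F)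
    {r : ZFSet → ZFSet → Prop}
    (hr : ∃ R ∈ F, ∀ z ∈ V_ γ, ∀ a ∈ V_ γ, ∀ b ∈ V_ γ, ∀ p ∈ V_ γ,
      IsOPairE memE p z a → (PairMemE memE R p b ↔ r a b))
    (hr' : ∃ R ∈ F, ∀ z ∈ V_ γ, ∀ a ∈ V_ γ, ∀ b ∈ V_ γ, ∀ p ∈ V_ γ,
      IsOPairE memE p z a → (PairMemE memE R p b ↔ r b a))
    (hd : ∃ R ∈ F, ∀ z ∈ V_ γ, ∀ a, z ∈ R ↔ r a a) {n : ℕ} (i j : Fin n) :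
    ∃ S ∈ F, ∀ v : Fin n → Vt γ, vtCode v ∈ S ↔ r (v i) (v j) := by
  induction n with
  | zero => exact i.elim0
  | succ n ih =>
    have hcode {m : ℕ} (v : Fin m → Vt γ) : vtCode v ∈ V_ γ :=
      mem_vonNeumann.2 (rank_vtCode_lt hγ v)
    induction i using Fin.lastCases with
    | last =>
      induction j using Fin.lastCases with
      | last =>
        obtain ⟨R, hR, h⟩ := hd
        exact ⟨R, hR, fun v => h _ (hcode v) _⟩
      | cast j => exact exists_code_last hγ hA (r := fun a b => r b a) hr' j
    | cast i =>
      induction j using Fin.lastCases with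
      | last => exact exists_code_last hγ hA hr i
      | cast j =>
        obtain ⟨S, hS, h⟩ := ih i j
        obtain ⟨R, hR, hRS⟩ := hA.1 S hS
        refine ⟨R, hR, fun v => ?_⟩
        rw [vtCode_succ, ← pairMemE_iff, hRS _ (hcode _) _ (mem_vonNeumann.2 (v _).2)]
        exact h _

lemma exists_code_formula (hγ : IsSuccLimit γ) (hA : AtomicE memE (V_ γ) F)
    (hL : LogicalE memE (V_ γ) F) {n : ℕ} (φ : LSet.BoundedFormula Empty n) :
    ∃ S ∈ F, ∀ v : Fin n → Vt γ, vtCode v ∈ S ↔ φ.Realize default v := by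
  have hcode {m : ℕ} (v : Fin m → Vt γ) : vtCode v ∈ V_ γ :=
    mem_vonNeumann.2 (rank_vtCode_lt hγ v)
  obtain ⟨⟨N, hN, hN'⟩, himp, hall⟩ := hL
  induction φ with
  | falsum => exact ⟨N, hN, fun v => iff_of_false (hN' _ (hcode v)) id⟩
  | equal t₁ t₂ =>
    obtain ⟨i, rfl⟩ := term_eq_var t₁
    obtain ⟨j, rfl⟩ := term_eq_var t₂
    have ⟨_, _, _, _, heq⟩ := hA
    obtain ⟨S, hS, h⟩ := exists_code_atomic hγ hA (r := fun a b => a = b) heq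
      (by simpa only [eq_comm] using heq)
      (by
        obtain ⟨R, hR, hR'⟩ := himp N hN N hN
        exact ⟨R, hR, fun z hz a => by simp [hR' z hz]⟩) i j
    refine ⟨S, hS, fun v => (h v).trans ?_⟩
    simp [BoundedFormula.Realize, Subtype.ext_iff]
  | rel R ts =>
    cases R
    obtain ⟨i, hi⟩ := term_eq_var (ts 0)
    obtain ⟨j, hj⟩ := term_eq_var (ts 1)
    have ⟨_, _, hmem, hmem', _⟩ := hA
    obtain ⟨S, hS, h⟩ := exists_code_atomic hγ hA (r := fun a b => a ∈ b) hmem hmem'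
      ⟨N, hN, fun z hz a => iff_of_false (hN' z hz) (mem_irrefl a)⟩ i j
    refine ⟨S, hS, fun v => (h v).trans ?_⟩
    simp only [BoundedFormula.Realize, Structure.RelMap, hi, hj, Term.realize_var, Sum.elim_inr]
  | imp φ ψ ih₁ ih₂ =>
    obtain ⟨S, hS, h⟩ := ih₁
    obtain ⟨S', hS', h'⟩ := ih₂
    obtain ⟨R, hR, hRS⟩ := himp S hS S' hS'
    refine ⟨R, hR, fun v => ?_⟩
    rw [BoundedFormula.realize_imp, ← h, ← h']
    exact hRS _ (hcode v)
  | all φ ih =>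
    obtain ⟨S, hS, h⟩ := ih
    obtain ⟨R, hR, hRS⟩ := hall S hS
    refine ⟨R, hR, fun v => (hRS _ (hcode v)).trans ?_⟩
    rw [BoundedFormula.realize_all]
    simp only [pairMemE_iff, memE, mem_vonNeumann, ← h, vtCode_snoc, Subtype.forall]

lemma vtCode_mem_of_tarskiVaughtE {κ : Ordinal} {y T : ZFSet}
    (hT : TarskiVaughtE memE (V_ κ) y F T) {n : ℕ} (v : Fin n → Vt κ) : vtCode v ∈ T := by
  obtain ⟨⟨e, he, he'⟩, hpair, -⟩ := hT
  induction n with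
  | zero =>
    rw [(eq_empty e).2 he'] at he
    exact he
  | succ n ih =>
    obtain ⟨p, hp, hp'⟩ := hpair _ (ih fun i => v i.castSucc) _
      (mem_vonNeumann.2 (v (Fin.last n)).2)
    rw [isOPairE_iff] at hp'
    rwa [vtCode_succ, ← hp']

/-- The inclusion of `V_κ` into `V_γ` as an embedding of structures. -/
def vtInclusion {κ γ : Ordinal} (h : κ ≤ γ) : Vt κ ↪[LSet] Vt γ where
  toFun x := ⟨x.1, x.2.trans_le h⟩
  inj' _ _ hxy := Subtype.ext (Subtype.mk.inj hxy)
  map_fun' f := isEmptyElim f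
  map_rel' r x := by
    cases r
    rfl

lemma vElem_of_matrix {κ : Ordinal} {T : ZFSet} (hκγ : κ ≤ γ) (hγ : IsSuccLimit γ)
    (hA : AtomicE memE (V_ γ) F) (hL : LogicalE memE (V_ γ) F)
    (hT : TarskiVaughtE memE (V_ κ) (V_ γ) F T) : VElem κ γ := by
  refine ⟨(vtInclusion hκγ).toElementaryEmbedding fun n φ v a ha => ?_, fun x => rfl⟩
  obtain ⟨S, hS, h⟩ := exists_code_formula hγ hA hL φ
  have hsnoc (b : Vt γ) : φ.Realize default (Fin.snoc (vtInclusion hκγ ∘ v) b : _ → Vt γ) ↔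
      pair (vtCode v) b ∈ S := by
    rw [← h, vtCode_snoc]
    rfl
  obtain ⟨b, hb, hb'⟩ := hT.2.2 S hS _ (vtCode_mem_of_tarskiVaughtE hT v)
    ⟨a, mem_vonNeumann.2 a.2, pairMemE_iff.2 ((hsnoc a).1 ha)⟩
  exact ⟨⟨b, mem_vonNeumann.1 hb⟩, (hsnoc _).2 (pairMemE_iff.1 hb')⟩

end ElementaryOfMatrix

section MatrixOfElementary

open Order ZFSet

/-- `P` restricts to a definable property of `n`-tuples over `V_γ`, for every `n`. -/
def CodesDefinable (γ : Ordinal) (P : ZFSet → Prop) : Prop :=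
  ∀ n, ∃ φ : LSet.BoundedFormula Empty n, ∀ v : Fin n → Vt γ, P (vtCode v) ↔ φ.Realize default v

/-- The set of all subsets of `V_γ` that are definable on tuples. -/
noncomputable def definableSubsets (γ : Ordinal) : ZFSet :=
  (powerset (V_ γ)).sep fun S => CodesDefinable γ (· ∈ S)

variable {γ : Ordinal} {P : ZFSet → Prop}

lemma CodesDefinable.sep_mem (hγ : IsSuccLimit γ) (h : CodesDefinable γ P) :
    (V_ γ).sep P ∈ definableSubsets γ := by
  refine mem_sep.2 ⟨mem_powerset.2 sep_subset, fun n => ?_⟩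
  obtain ⟨φ, hφ⟩ := h n
  exact ⟨φ, fun v =>
    (mem_sep.trans (and_iff_right (mem_vonNeumann.2 (rank_vtCode_lt hγ v)))).trans (hφ v)⟩

lemma codesDefinable_of_mem {S : ZFSet} (hS : S ∈ definableSubsets γ) :
    CodesDefinable γ (· ∈ S) :=
  (mem_sep.1 hS).2

lemma exists_realize_comp {m n : ℕ} (φ : LSet.BoundedFormula Empty m) (f : Fin m → Fin n) :
    ∃ ψ : LSet.BoundedFormula Empty n, ∀ v : Fin n → Vt γ,
      ψ.Realize default v ↔ φ.Realize default (v ∘ f) := by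
  refine ⟨BoundedFormula.relabel (n := n) (k := 0) (Sum.map id f) φ.toFormula, fun v => ?_⟩
  rw [BoundedFormula.realize_relabel]
  have := φ.realize_toFormula (M := Vt γ) (Sum.elim default (v ∘ f))
  rw [Sum.elim_comp_inl, Sum.elim_comp_inr] at this
  rw [← this, Formula.Realize]
  refine iff_of_eq (congrArg₂ _ ?_ (Subsingleton.elim _ _))
  funext i
  rcases i with i | i
  · exact i.elim
  · rfl

/-- If `Q` is definable on pairs of a tuple and an element, the set of pairs satisfying `Q` is
definable on tuples. -/
lemma codesDefinable_pair {Q : ZFSet → ZFSet → Prop}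
    (h : ∀ n, ∃ φ : LSet.BoundedFormula Empty (n + 1), ∀ v : Fin (n + 1) → Vt γ,
      Q (vtCode fun i => v i.castSucc) (v (Fin.last n)) ↔ φ.Realize default v) :
    CodesDefinable γ fun p => ∃ z b, p = pair z b ∧ Q z b := by
  intro n
  cases n with
  | zero =>
    refine ⟨⊥, fun v => iff_of_false ?_ id⟩
    rintro ⟨z, b, h, -⟩
    exact empty_ne_pair _ _ h
  | succ n =>
    obtain ⟨φ, hφ⟩ := h n
    refine ⟨φ, fun v => ?_⟩
    rw [← hφ, vtCode_succ]
    simp [pair_inj]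

lemma codesDefinable_triple {Q : ZFSet → ZFSet → ZFSet → Prop}
    (h : ∀ n, ∃ φ : LSet.BoundedFormula Empty (n + 2), ∀ v : Fin (n + 2) → Vt γ,
      Q (vtCode fun i => v i.castSucc.castSucc) (v (Fin.last n).castSucc) (v (Fin.last (n + 1))) ↔
        φ.Realize default v) :
    CodesDefinable γ fun p => ∃ q b, p = pair q b ∧ ∃ z a, q = pair z a ∧ Q z a b := by
  refine codesDefinable_pair fun n => ?_
  cases n with
  | zero =>
    refine ⟨⊥, fun v => iff_of_false ?_ id⟩
    rintro ⟨z, b, h, -⟩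
    exact empty_ne_pair _ _ h
  | succ n =>
    obtain ⟨φ, hφ⟩ := h n
    refine ⟨φ, fun v => ?_⟩
    rw [← hφ, vtCode_succ]
    simp [pair_inj]

lemma exists_triple_relation (hγ : IsSuccLimit γ) {Q : ZFSet → ZFSet → ZFSet → Prop}
    (h : ∀ n, ∃ φ : LSet.BoundedFormula Empty (n + 2), ∀ v : Fin (n + 2) → Vt γ,
      Q (vtCode fun i => v i.castSucc.castSucc) (v (Fin.last n).castSucc) (v (Fin.last (n + 1))) ↔
        φ.Realize default v) :
    ∃ R, R ∈ definableSubsets γ ∧ ∀ z ∈ V_ γ, ∀ a ∈ V_ γ, ∀ b ∈ V_ γ, ∀ p ∈ V_ γ,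
      IsOPairE memE p z a → (PairMemE memE R p b ↔ Q z a b) := by
  refine ⟨_, (codesDefinable_triple h).sep_mem hγ, fun z _ a _ b hb p hp hpz => ?_⟩
  obtain rfl := isOPairE_iff.1 hpz
  rw [pairMemE_iff, mem_sep, and_iff_right]
  · simp [pair_inj]
  · rw [mem_vonNeumann] at *
    exact rank_opair_lt hγ hp hb

lemma atomicE_definableSubsets (hγ : IsSuccLimit γ) :
    AtomicE memE (V_ γ) (definableSubsets γ) := by
  refine ⟨fun S hS => ?_, fun S hS => exists_triple_relation hγ fun n => ?_,
    exists_triple_relation hγ fun n => ?_, exists_triple_relation hγ fun n => ?_,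
    exists_triple_relation hγ fun n => ?_⟩
  · refine ⟨_, (codesDefinable_pair (Q := fun z _ => z ∈ S) fun n => ?_).sep_mem hγ,
      fun z hz b hb => ?_⟩
    · obtain ⟨φ, hφ⟩ := codesDefinable_of_mem hS n
      obtain ⟨ψ, hψ⟩ := exists_realize_comp (γ := γ) φ Fin.castSucc
      exact ⟨ψ, fun v => (hφ _).trans (hψ v).symm⟩
    · rw [pairMemE_iff, mem_sep, and_iff_right]
      · simp [pair_inj]
      · simp only [memE, mem_vonNeumann] at *
        exact rank_opair_lt hγ hz hb
  · obtain ⟨φ, hφ⟩ := codesDefinable_of_mem hS (n + 1)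
    obtain ⟨ψ, hψ⟩ := exists_realize_comp (γ := γ) φ
      (Fin.snoc (fun i => i.castSucc.castSucc) (Fin.last (n + 1)) : Fin (n + 1) → Fin (n + 2))
    refine ⟨ψ, fun v => ?_⟩
    rw [hψ, ← hφ, vtCode_succ, pairMemE_iff]
    simp
  · refine ⟨memBF (Term.var (Sum.inr (Fin.last n).castSucc)) (Term.var (Sum.inr (Fin.last _))),
      fun v => ?_⟩
    rw [memBF, BoundedFormula.realize_rel₂]
    rfl
  · refine ⟨memBF (Term.var (Sum.inr (Fin.last _))) (Term.var (Sum.inr (Fin.last n).castSucc)),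
      fun v => ?_⟩
    rw [memBF, BoundedFormula.realize_rel₂]
    rfl
  · refine ⟨(Term.var (Sum.inr (Fin.last n).castSucc)).bdEqual (Term.var (Sum.inr (Fin.last _))),
      fun v => ?_⟩
    rw [BoundedFormula.realize_bdEqual]
    exact Subtype.ext_iff.symm

lemma logicalE_definableSubsets (hγ : IsSuccLimit γ) :
    LogicalE memE (V_ γ) (definableSubsets γ) := by
  refine ⟨?_, fun S hS S' hS' => ?_, fun S hS => ?_⟩
  · refine ⟨_, CodesDefinable.sep_mem hγ (P := fun _ => False) fun n => ⟨⊥, fun v => Iff.rfl⟩, ?_⟩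
    simp
  · refine ⟨_, CodesDefinable.sep_mem hγ (P := fun z => z ∈ S → z ∈ S') fun n => ?_,
      fun z hz => ?_⟩
    · obtain ⟨φ, hφ⟩ := codesDefinable_of_mem hS n
      obtain ⟨ψ, hψ⟩ := codesDefinable_of_mem hS' n
      exact ⟨φ.imp ψ, fun v => by rw [BoundedFormula.realize_imp, ← hφ, ← hψ]⟩
    · rw [memE, mem_sep, and_iff_right hz]
  · refine ⟨_, CodesDefinable.sep_mem hγ (P := fun z => ∀ b ∈ V_ γ, pair z b ∈ S) fun n => ?_,
      fun z hz => ?_⟩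
    · obtain ⟨φ, hφ⟩ := codesDefinable_of_mem hS (n + 1)
      refine ⟨φ.all, fun v => ?_⟩
      simp only [BoundedFormula.realize_all, ← hφ, vtCode_snoc, mem_vonNeumann, Subtype.forall]
    · rw [memE, mem_sep, and_iff_right hz]
      simp only [pairMemE_iff]

lemma VElem.exists_tarskiVaughtE {κ : Ordinal} (hκ : IsSuccLimit κ) (h : VElem κ γ) :
    ∃ T, TarskiVaughtE memE (V_ κ) (V_ γ) (definableSubsets γ) T := by
  obtain ⟨e, he⟩ := h
  have hcode {n : ℕ} (v : Fin n → Vt κ) : vtCode (e ∘ v) = vtCode v := by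
    simp only [vtCode, Function.comp_apply, he]
  have hT (z : ZFSet) : z ∈ ((V_ κ).sep fun z => ∃ (n : ℕ) (v : Fin n → Vt κ), vtCode v = z) ↔
      ∃ (n : ℕ) (v : Fin n → Vt κ), vtCode v = z := by
    rw [mem_sep, and_iff_right_iff_imp]
    rintro ⟨n, v, rfl⟩
    exact mem_vonNeumann.2 (rank_vtCode_lt hκ v)
  refine ⟨(V_ κ).sep fun z => ∃ (n : ℕ) (v : Fin n → Vt κ), vtCode v = z,
    ⟨∅, (hT _).2 ⟨0, Fin.elim0, rfl⟩, fun c hc => notMem_empty c hc⟩, fun z hz b hb => ?_,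
    fun S hS z hz => ?_⟩
  · obtain ⟨n, v, rfl⟩ := (hT z).1 hz
    exact ⟨_, (hT _).2 ⟨n + 1, Fin.snoc v ⟨b, mem_vonNeumann.1 hb⟩, rfl⟩,
      isOPairE_iff.2 (vtCode_snoc _ _)⟩
  · obtain ⟨n, v, rfl⟩ := (hT z).1 hz
    rintro ⟨b, hb, hbS⟩
    obtain ⟨φ, hφ⟩ := codesDefinable_of_mem hS (n + 1)
    have hex : φ.ex.Realize (e ∘ default) (e ∘ v) := by
      refine BoundedFormula.realize_ex.2 ⟨⟨b, mem_vonNeumann.1 hb⟩, ?_⟩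
      rw [Subsingleton.elim (e ∘ default) default, ← hφ, vtCode_snoc, hcode]
      exact pairMemE_iff.1 hbS
    rw [e.map_boundedFormula, BoundedFormula.realize_ex] at hex
    obtain ⟨b', hb'⟩ := hex
    refine ⟨b', mem_vonNeumann.2 b'.2, pairMemE_iff.2 ?_⟩
    rw [← e.map_boundedFormula, Subsingleton.elim (e ∘ default) default, ← hφ, hcode,
      vtCode_snoc] at hb'
    exact hb'

end MatrixOfElementary

section Reflection

open ZFSet

lemma IsUplifting.upliftingE {κ : Ordinal} (h : IsUplifting κ) : UpliftingE memE (V_ κ) := by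
  intro t
  obtain ⟨γ, hγ, htγ, hκγ, helem⟩ := h.2 (Order.succ t.rank)
  obtain ⟨T, hT⟩ := helem.exists_tarskiVaughtE h.1.isSuccLimit
  exact ⟨V_ γ, definableSubsets γ, T, fun z => ⟨h.1.univE z, hγ.univE z,
    mem_vonNeumann.2 (Order.succ_le_iff.1 htγ), vonNeumann_mem_of_lt hκγ,
    atomicE_definableSubsets hγ.isSuccLimit, logicalE_definableSubsets hγ.isSuccLimit, hT⟩⟩

lemma UpliftingE.isUplifting_rank {x : ZFSet} (h : UpliftingE memE x) : IsUplifting x.rank := by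
  refine ⟨?_, fun θ => ?_⟩
  · obtain ⟨y, F, T, h⟩ := h ∅
    exact isInaccOrd_rank fun z => (h z).1
  · obtain ⟨y, F, T, h⟩ := h (V_ θ)
    have hy := isInaccOrd_rank fun z => (h z).2.1
    obtain ⟨-, -, hθ, hxy, hA, hL, hT⟩ := h ∅
    have hlt := rank_lt_of_mem hxy
    rw [eq_vonNeumann_rank fun z => (h z).2.1] at hA hL hT
    rw [eq_vonNeumann_rank fun z => (h z).1] at hT
    refine ⟨y.rank, hy, ?_, hlt, vElem_of_matrix hlt.le hy.isSuccLimit hA hL hT⟩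
    simpa using (rank_lt_of_mem hθ).le

lemma SigmaReflecting.exists_isUplifting {β κ : Ordinal} (hβ : SigmaReflecting 4 β)
    (hκ : IsUplifting κ) : ∃ α < β, IsUplifting α := by
  obtain ⟨hinacc, hrefl⟩ := hβ
  obtain ⟨φ, hφ, hφ'⟩ := SigmaDef.ex (ι := Fin 1) (n := 0) (R := fun _ E _ b => UpliftingE E b)
    (piDef_upliftingE (Sum.inr (Fin.last 0))).sigmaDef
  obtain ⟨ψ, hψ, hψ'⟩ := (piDef_upliftingE (ι := Fin 1) (n := 0) (Sum.inl 0)).sigmaDef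
  have hφr (M : Type 1) [LSet.Structure M] (a : M) : Formula.Realize φ (fun _ : Fin 1 => a) ↔
      ∃ x : M, UpliftingE (fun a b => Structure.RelMap Language.adj ![a, b]) x :=
    hφ' M (Sum.elim (fun _ => a) default)
  have hψr (M : Type 1) [LSet.Structure M] (a : M) : Formula.Realize ψ (fun _ : Fin 1 => a) ↔
      UpliftingE (fun a b => Structure.RelMap Language.adj ![a, b]) a :=
    hψ' M (Sum.elim (fun _ => a) default)
  have h0 : (∅ : ZFSet).rank < β := by simpa using hinacc.isSuccLimit.bot_lt
  obtain ⟨x, hx⟩ := (hφr _ _).1 ((hrefl φ hφ ∅ h0).1 ((hφr _ _).2 ⟨V_ κ, hκ.upliftingE⟩))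
  have hx' := (hψr _ _).1 ((hrefl ψ hψ x x.2).2 ((hψr _ _).2 hx))
  exact ⟨_, x.2, UpliftingE.isUplifting_rank hx'⟩

end Reflection

/-- If `κ` is the least uplifting cardinal, then `κ` is not Σ₄-reflecting and there are no
Σ₄-reflecting cardinals below `κ`. -/
theorem least_uplifting_not_sigma4_reflecting (κ : Ordinal) (h : IsUplifting κ)
    (hleast : ∀ β < κ, ¬ IsUplifting β) :
    ¬ SigmaReflecting 4 κ ∧ ∀ β < κ, ¬ SigmaReflecting 4 β := by
  have key : ∀ β ≤ κ, ¬ SigmaReflecting 4 β := fun β hβ hr =>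
    let ⟨α, hα, hup⟩ := hr.exists_isUplifting h
    hleast α (hα.trans_le hβ) hup
  exact ⟨key κ le_rfl, fun β hβ => key β hβ.le⟩

end Paper
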